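/- (Sufficient condition for feasibility.) Let G be a priority graph. If there exists ε > 0 such that for every elementary directed cycle C of G one has ⋂_{(i,j) ∈ E(C)} (χ^obs_{i≻j} + [−ε,ε]^n) = ∅ (Minkowski sum), then Φ(χ^free_G) ≠ ∅. -/

import Mathlib

open Set

noncomputable section

/-- Canonical basis vector `e i` of the coordination space `ℝ^n`. -/
def basisVec (n : ℕ) (i : Fin n) : Fin n → ℝ := Pi.single i 1

/-- Collision cylinder `χ^obs_{ij} = {x : (x i, x j) ∈ κ i j}`. -/
def cyl (n : ℕ) (κ : Fin n → Fin n → Set (ℝ × ℝ)) (i j : Fin n) : Set (Fin n → ℝ) :=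
  {x | (x i, x j) ∈ κ i j}

/-- Completed cylinder `χ^obs_{i≻j} = χ^obs_{ij} − ℝ₊ e_i + ℝ₊ e_j` (Minkowski sums). -/
def cylPr (n : ℕ) (κ : Fin n → Fin n → Set (ℝ × ℝ)) (i j : Fin n) : Set (Fin n → ℝ) :=
  {z | ∃ y ∈ cyl n κ i j, ∃ a b : ℝ, 0 ≤ a ∧ 0 ≤ b ∧
    z = y - a • basisVec n i + b • basisVec n j}

/-- Obstacle region `χ^obs = ⋃_{i,j} χ^obs_{ij}`. -/
def obsRegion (n : ℕ) (κ : Fin n → Fin n → Set (ℝ × ℝ)) : Set (Fin n → ℝ) :=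
  ⋃ i, ⋃ j, cyl n κ i j

/-- Obstacle-free region `χ^free = χ \ χ^obs`. -/
def freeRegion (n : ℕ) (κ : Fin n → Fin n → Set (ℝ × ℝ)) : Set (Fin n → ℝ) :=
  (obsRegion n κ)ᶜ

/-- Standing hypotheses on the collision data `κ`: each `κ i j` is open, bounded and
convex, `κ i i = ∅`, and `(a,b) ∈ κ i j ↔ (b,a) ∈ κ j i`. -/
def KappaHyp (n : ℕ) (κ : Fin n → Fin n → Set (ℝ × ℝ)) : Prop :=
  (∀ i j, IsOpen (κ i j)) ∧ (∀ i j, Bornology.IsBounded (κ i j)) ∧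
  (∀ i j, Convex ℝ (κ i j)) ∧ (∀ i, κ i i = ∅) ∧
  (∀ (i j : Fin n) (a b : ℝ), (a, b) ∈ κ i j ↔ (b, a) ∈ κ j i)

/-- `PhiMem n C φ` : `φ` restricted to `[0,1]` is a continuous nondecreasing path whose
image lies in `C`, with `φ 0 − ℝ₊^n ⊆ C` and `φ 1 + ℝ₊^n ⊆ C` (the set `Φ(C)`). -/
def PhiMem (n : ℕ) (C : Set (Fin n → ℝ)) (φ : ℝ → Fin n → ℝ) : Prop :=
  ContinuousOn φ (Icc 0 1) ∧
  (∀ t1 ∈ Icc (0:ℝ) 1, ∀ t2 ∈ Icc (0:ℝ) 1, t1 ≤ t2 → φ t1 ≤ φ t2) ∧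
  (∀ t ∈ Icc (0:ℝ) 1, φ t ∈ C) ∧
  (∀ d : Fin n → ℝ, 0 ≤ d → φ 0 - d ∈ C) ∧
  (∀ d : Fin n → ℝ, 0 ≤ d → φ 1 + d ∈ C)

/-- A priority graph: `E i j ↔ (χ^obs_{ij} ≠ ∅ ∧ ¬ E j i)`. -/
def IsPriorityGraph (n : ℕ) (κ : Fin n → Fin n → Set (ℝ × ℝ))
    (E : Fin n → Fin n → Prop) : Prop :=
  ∀ i j, E i j ↔ (cyl n κ i j ≠ ∅ ∧ ¬ E j i)

/-- Completed obstacle region `χ^obs_G = ⋃_{(i,j) ∈ E(G)} χ^obs_{i≻j}`. -/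
def obsG (n : ℕ) (κ : Fin n → Fin n → Set (ℝ × ℝ))
    (E : Fin n → Fin n → Prop) : Set (Fin n → ℝ) :=
  ⋃ i, ⋃ j, ⋃ (_ : E i j), cylPr n κ i j

/-- `χ^free_G = χ \ χ^obs_G`. -/
def freeG (n : ℕ) (κ : Fin n → Fin n → Set (ℝ × ℝ))
    (E : Fin n → Fin n → Prop) : Set (Fin n → ℝ) :=
  (obsG n κ E)ᶜ

/-- `E` contains a directed cycle. -/
def HasCycle (n : ℕ) (E : Fin n → Fin n → Prop) : Prop :=
  ∃ (m : ℕ) (v : ℕ → Fin n), 0 < m ∧ v m = v 0 ∧ ∀ k < m, E (v k) (v (k+1))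

/-- `(m, v)` describes an elementary directed cycle of `E`: it has positive length,
closes up, all its steps are edges of `E` and it visits no vertex twice. -/
def IsElemCycle (n : ℕ) (E : Fin n → Fin n → Prop) (m : ℕ) (v : ℕ → Fin n) : Prop :=
  0 < m ∧ v m = v 0 ∧ (∀ k < m, E (v k) (v (k+1))) ∧
  ∀ k < m, ∀ l < m, v k = v l → k = l

/-- The obstacle region lies in a bounded region: there are `x̲^obs, x̄^obs ∈ χ^free`
bounding every collision cylinder in the relevant coordinates. -/
def ObsBounds (n : ℕ) (κ : Fin n → Fin n → Set (ℝ × ℝ))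
    (xlo xhi : Fin n → ℝ) : Prop :=
  xlo ∈ freeRegion n κ ∧ xhi ∈ freeRegion n κ ∧
  ∀ i j : Fin n, ∀ x ∈ cyl n κ i j,
    (xlo i < x i ∧ x i < xhi i) ∧ (xlo j < x j ∧ x j < xhi j)

/-- Minkowski sum (dilation) `A + [−r,r]^n`. -/
def dil (n : ℕ) (A : Set (Fin n → ℝ)) (r : ℝ) : Set (Fin n → ℝ) :=
  {z | ∃ y ∈ A, ∃ d : Fin n → ℝ, (∀ i, |d i| ≤ r) ∧ z = y + d}

/-- The pairs of coordinates `(a, b)` dominated by a collision of a set `K ⊆ ℝ²`, in the sense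
that `a ≤ p` and `q ≤ b` for some `(p, q) ∈ K`. -/
def Blocked (K : Set (ℝ × ℝ)) (a b : ℝ) : Prop :=
  ∃ p q, (p, q) ∈ K ∧ a ≤ p ∧ q ≤ b

lemma Blocked.mono {K : Set (ℝ × ℝ)} {a b a' b' : ℝ} (h : Blocked K a b) (ha : a' ≤ a)
    (hb : b ≤ b') : Blocked K a' b' := by
  obtain ⟨p, q, hK, hp, hq⟩ := h
  exact ⟨p, q, hK, ha.trans hp, hq.trans hb⟩

lemma mem_cylPr_iff {n : ℕ} {κ : Fin n → Fin n → Set (ℝ × ℝ)} {i j : Fin n} (hij : i ≠ j)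
    (z : Fin n → ℝ) : z ∈ cylPr n κ i j ↔ Blocked (κ i j) (z i) (z j) := by
  constructor
  · rintro ⟨y, hy, a, b, ha, hb, rfl⟩
    refine ⟨y i, y j, hy, ?_, ?_⟩ <;> simp [basisVec, hij, hij.symm, ha, hb]
  · rintro ⟨p, q, hK, hp, hq⟩
    refine ⟨Function.update (Function.update z i p) j q, by simpa [cyl, hij] using hK,
      p - z i, z j - q, by linarith, by linarith, ?_⟩
    ext k
    by_cases hki : k = i
    · subst hki
      simp [basisVec, hij]
    · by_cases hkj : k = j
      · subst hkj
        simp [basisVec, hki]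
      · simp [basisVec, hki, hkj]

lemma IsPriorityGraph.ne {n : ℕ} {κ : Fin n → Fin n → Set (ℝ × ℝ)} {E : Fin n → Fin n → Prop}
    (hE : IsPriorityGraph n κ E) {i j : Fin n} (h : E i j) : i ≠ j := by
  rintro rfl
  exact ((hE i i).1 h).2 h

lemma IsPriorityGraph.mem_freeG_iff {n : ℕ} {κ : Fin n → Fin n → Set (ℝ × ℝ)}
    {E : Fin n → Fin n → Prop} (hE : IsPriorityGraph n κ E) (x : Fin n → ℝ) :
    x ∈ freeG n κ E ↔ ∀ i j, E i j → ¬ Blocked (κ i j) (x i) (x j) := by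
  simp only [freeG, obsG, mem_compl_iff, mem_iUnion, not_exists]
  exact forall₃_congr fun i j h => not_congr (mem_cylPr_iff (hE.ne h) x)

lemma ObsBounds.lt_of_mem {n : ℕ} {κ : Fin n → Fin n → Set (ℝ × ℝ)} {xlo xhi : Fin n → ℝ}
    (hbd : ObsBounds n κ xlo xhi) {i j : Fin n} (hij : i ≠ j) {p q : ℝ} (h : (p, q) ∈ κ i j) :
    p < xhi i ∧ xlo j < q := by
  have := hbd.2.2 i j (Function.update (Function.update 0 i p) j q) (by simpa [cyl, hij] using h)
  simp only [Function.update_self, Function.update_of_ne hij] at this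
  exact ⟨this.1.2, this.2.1⟩

/-- A relation in which every vertex satisfying `p` has a predecessor satisfying `p` has an
elementary cycle, provided some vertex satisfies `p`. -/
lemma exists_isElemCycle {n : ℕ} {E : Fin n → Fin n → Prop} {p : Fin n → Prop} {i₀ : Fin n}
    (hi₀ : p i₀) (h : ∀ i, p i → ∃ j, p j ∧ E j i) :
    ∃ m v, IsElemCycle n E m v := by
  choose! f hfp hfE using h
  have hp : ∀ k i, p i → p (f^[k] i) := fun k => by
    induction k with
    | zero => exact fun i hi => hi
    | succ k ih => exact fun i hi => ih _ (hfp i hi)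
  obtain ⟨a, b, hab, heq⟩ : ∃ a b, a < b ∧ f^[a] i₀ = f^[b] i₀ := by
    obtain ⟨a, b, hne, heq⟩ := Finite.exists_ne_map_eq_of_infinite fun k : ℕ => f^[k] i₀
    rcases hne.lt_or_gt with h | h
    · exact ⟨a, b, h, heq⟩
    · exact ⟨b, a, h, heq.symm⟩
  set w := f^[a] i₀
  have hw : p w := hp a i₀ hi₀
  have hper : w ∈ Function.periodicPts f := by
    refine ⟨b - a, by omega, ?_⟩
    rw [Function.IsPeriodicPt, Function.IsFixedPt, ← Function.iterate_add_apply,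
      Nat.sub_add_cancel hab.le, ← heq]
  clear_value w
  set m := Function.minimalPeriod f w
  have hm : 0 < m := Function.minimalPeriod_pos_of_mem_periodicPts hper
  refine ⟨m, fun k => f^[m - k] w, hm, ?_, ?_, ?_⟩
  · simp [m, Function.iterate_minimalPeriod]
  · intro k hk
    have : m - k = (m - (k + 1)) + 1 := by omega
    simp only [this, Function.iterate_succ_apply']
    exact hfE _ (hp _ _ hw)
  · intro k hk l hl hkl
    have key : ∀ k < m, ∀ l < m, k ≤ l → f^[m - k] w = f^[m - l] w → k = l := by
      intro k hk l hl hle hkl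
      have h1 : Function.IsPeriodicPt f (l - k) w := by
        have h2 := congrArg f^[l] hkl
        rw [← Function.iterate_add_apply, ← Function.iterate_add_apply,
          show l + (m - k) = (l - k) + m by omega, show l + (m - l) = m by omega,
          Function.iterate_add_apply, Function.iterate_minimalPeriod] at h2
        exact h2
      have h3 := Nat.eq_zero_of_dvd_of_lt h1.minimalPeriod_dvd (by omega)
      omega
    rcases le_total k l with hle | hle
    · exact key k hk l hl hle hkl
    · exact (key l hl k hk hle hkl.symm).symm

/-- `x` can be joined to `y` by a nondecreasing path in `C`, parametrized by `ℝ` and constant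
outside of `[0,1]`. -/
def MonoJoined {n : ℕ} (C : Set (Fin n → ℝ)) (x y : Fin n → ℝ) : Prop :=
  ∃ φ : ℝ → Fin n → ℝ, Continuous φ ∧ Monotone φ ∧ (∀ t, φ t ∈ C) ∧
    (∀ t ≤ 0, φ t = x) ∧ ∀ t, 1 ≤ t → φ t = y

lemma MonoJoined.refl {n : ℕ} {C : Set (Fin n → ℝ)} {x : Fin n → ℝ} (hx : x ∈ C) :
    MonoJoined C x x :=
  ⟨fun _ => x, continuous_const, monotone_const, fun _ => hx, fun _ _ => rfl, fun _ _ => rfl⟩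

lemma MonoJoined.trans {n : ℕ} {C : Set (Fin n → ℝ)} {x y z : Fin n → ℝ}
    (hxy : MonoJoined C x y) (hyz : MonoJoined C y z) : MonoJoined C x z := by
  obtain ⟨φ, hφc, hφm, hφC, hφ0, hφ1⟩ := hxy
  obtain ⟨ψ, hψc, hψm, hψC, hψ0, hψ1⟩ := hyz
  have hl : ∀ t : ℝ, t ≤ 1 / 2 → φ (2 * t) + ψ (2 * t - 1) - y = φ (2 * t) := fun t ht => by
    rw [hψ0 _ (by linarith)]
    simp
  have hr : ∀ t : ℝ, 1 / 2 ≤ t → φ (2 * t) + ψ (2 * t - 1) - y = ψ (2 * t - 1) := fun t ht => by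
    rw [hφ1 _ (by linarith)]
    simp
  refine ⟨fun t => φ (2 * t) + ψ (2 * t - 1) - y, by fun_prop, fun s t hst => ?_, fun t => ?_,
    fun t ht => ?_, fun t ht => ?_⟩
  · exact sub_le_sub_right (add_le_add (hφm (by linarith)) (hψm (by linarith))) _
  · rcases le_total t (1 / 2) with ht | ht
    · simpa only [hl t ht] using hφC _
    · simpa only [hr t ht] using hψC _
  · simp only [hl t (by linarith)]
    exact hφ0 _ (by linarith)
  · simp only [hr t (by linarith)]
    exact hψ1 _ (by linarith)

lemma MonoJoined.of_Icc_subset {n : ℕ} {C : Set (Fin n → ℝ)} {x y : Fin n → ℝ} (hxy : x ≤ y)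
    (hC : Icc x y ⊆ C) : MonoJoined C x y := by
  have hmono : Monotone fun t : ℝ => x + max 0 (min t 1) • (y - x) := fun s t hst => by
    have : max 0 (min s 1) ≤ max 0 (min t 1) := by gcongr
    exact add_le_add_right (smul_le_smul_of_nonneg_right this (sub_nonneg.2 hxy)) x
  have h0 : ∀ t : ℝ, t ≤ 0 → x + max 0 (min t 1) • (y - x) = x := fun t ht => by
    rw [max_eq_left (min_le_of_left_le ht)]
    simp
  have h1 : ∀ t : ℝ, 1 ≤ t → x + max 0 (min t 1) • (y - x) = y := fun t ht => by
    rw [min_eq_right ht]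
    simp
  refine ⟨_, by fun_prop, hmono, fun t => hC ⟨?_, ?_⟩, h0, h1⟩
  · simpa only [h0 _ (min_le_right t 0)] using hmono (min_le_left t 0)
  · simpa only [h1 _ (le_max_right t 1)] using hmono (le_max_left t 1)

lemma IsPriorityGraph.Icc_update_subset_freeG {n : ℕ} {κ : Fin n → Fin n → Set (ℝ × ℝ)}
    {E : Fin n → Fin n → Prop} (hE : IsPriorityGraph n κ E) {x : Fin n → ℝ} {i : Fin n} {a : ℝ}
    (hx : x ∈ freeG n κ E) (hy : Function.update x i a ∈ freeG n κ E) :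
    Icc x (Function.update x i a) ⊆ freeG n κ E := by
  rw [hE.mem_freeG_iff] at hx hy
  rintro z ⟨hxz, hzy⟩
  rw [hE.mem_freeG_iff]
  intro j k hjk hz
  by_cases hk : k = i
  · subst hk
    refine hy j k hjk (hz.mono ?_ (hzy k))
    rw [Function.update_of_ne (hE.ne hjk)]
    exact hxz j
  · refine hx j k hjk (hz.mono (hxz j) ?_)
    simpa [hk] using hzy k

/-- A free position that is not final has a robot able to advance by `ε`, or up to its final
position. -/
lemma exists_update_mem_freeG {n : ℕ} {κ : Fin n → Fin n → Set (ℝ × ℝ)} {xlo xhi : Fin n → ℝ}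
    (hbd : ObsBounds n κ xlo xhi) {E : Fin n → Fin n → Prop} (hE : IsPriorityGraph n κ E)
    {ε : ℝ} (hε : 0 < ε)
    (hcyc : ∀ (m : ℕ) (v : ℕ → Fin n), IsElemCycle n E m v →
      ⋂ k ∈ Finset.range m, dil n (cylPr n κ (v k) (v (k+1))) ε = ∅)
    {x : Fin n → ℝ} (hx : x ∈ freeG n κ E) {i₀ : Fin n} (hi₀ : x i₀ < xhi i₀) :
    ∃ i, x i < xhi i ∧ Function.update x i (min (x i + ε) (xhi i)) ∈ freeG n κ E := by
  by_contra! hstuck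
  have hpred : ∀ i, x i < xhi i →
      ∃ j, x j < xhi j ∧ (E j i ∧ x ∈ dil n (cylPr n κ j i) ε) := by
    intro i hi
    have hxi : x i ≤ min (x i + ε) (xhi i) := le_min (by linarith) hi.le
    have hxy := le_update_self_iff.2 hxi
    have hblock := hstuck i hi
    rw [hE.mem_freeG_iff] at hblock hx
    push Not at hblock
    obtain ⟨j, k, hjk, hb⟩ := hblock
    obtain rfl : k = i := by
      by_contra hk
      rw [Function.update_of_ne hk] at hb
      exact hx j k hjk (hb.mono (hxy j) le_rfl)
    have hne := hE.ne hjk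
    refine ⟨j, ?_, hjk, _, (mem_cylPr_iff hne _).2 hb,
      x - Function.update x k (min (x k + ε) (xhi k)), fun l => ?_, by simp⟩
    · obtain ⟨p, q, hK, hp, -⟩ := hb
      rw [Function.update_of_ne hne] at hp
      exact hp.trans_lt (hbd.lt_of_mem hne hK).1
    · by_cases hl : l = k
      · subst hl
        rw [Pi.sub_apply, Function.update_self, abs_le]
        constructor <;> linarith [min_le_left (x l + ε) (xhi l)]
      · simp [hl, hε.le]
  obtain ⟨m, v, hm, hv, hEv, hinj⟩ := exists_isElemCycle hi₀ hpred
  have hmem : x ∈ ⋂ k ∈ Finset.range m, dil n (cylPr n κ (v k) (v (k+1))) ε :=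
    mem_iInter₂.2 fun k hk => (hEv k (Finset.mem_range.1 hk)).2
  rw [hcyc m v ⟨hm, hv, fun k hk => (hEv k hk).1, hinj⟩] at hmem
  exact hmem

lemma monoJoined_freeG {n : ℕ} {κ : Fin n → Fin n → Set (ℝ × ℝ)} {xlo xhi : Fin n → ℝ}
    (hbd : ObsBounds n κ xlo xhi) {E : Fin n → Fin n → Prop} (hE : IsPriorityGraph n κ E)
    {ε : ℝ} (hε : 0 < ε)
    (hcyc : ∀ (m : ℕ) (v : ℕ → Fin n), IsElemCycle n E m v →
      ⋂ k ∈ Finset.range m, dil n (cylPr n κ (v k) (v (k+1))) ε = ∅)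
    {x : Fin n → ℝ} (hx : x ∈ freeG n κ E) (hxhi : x ≤ xhi) :
    MonoJoined (freeG n κ E) x xhi := by
  induction hN : ∑ i, ⌈(xhi i - x i) / ε⌉₊ using Nat.strong_induction_on generalizing x with
  | h N ih =>
    by_cases hall : ∀ i, xhi i ≤ x i
    · obtain rfl : x = xhi := le_antisymm hxhi hall
      exact .refl hx
    push Not at hall
    obtain ⟨i₀, hi₀⟩ := hall
    obtain ⟨i, hi, hy⟩ := exists_update_mem_freeG hbd hE hε hcyc hx hi₀
    have hxi : x i ≤ min (x i + ε) (xhi i) := le_min (by linarith) hi.le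
    have hxy := le_update_self_iff.2 hxi
    refine (MonoJoined.of_Icc_subset hxy (hE.Icc_update_subset_freeG hx hy)).trans
      (ih _ ?_ hy (update_le_iff.2 ⟨min_le_right _ _, fun j _ => hxhi j⟩) rfl)
    rw [← hN]
    refine Finset.sum_lt_sum (fun j _ => ?_) ⟨i, Finset.mem_univ i, ?_⟩
    · have := hxy j
      gcongr
    · have hpos : 0 < (xhi i - x i) / ε := div_pos (by linarith) hε
      rw [Function.update_self, Nat.lt_ceil]
      rcases min_choice (x i + ε) (xhi i) with h | h <;> rw [h]
      · have hsub : (xhi i - (x i + ε)) / ε = (xhi i - x i) / ε - 1 := by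
          field_simp
          ring
        have hnn : 0 ≤ (xhi i - x i) / ε - 1 := by
          rw [← hsub]
          exact div_nonneg (by linarith [min_eq_left_iff.1 h]) hε.le
        rw [hsub]
        linarith [Nat.ceil_lt_add_one hnn]
      · simpa using hpos

/-- sufficient condition for feasibility: if for some `ε > 0` every
elementary cycle of `G` has empty intersection of the `ε`-dilated completed
cylinders, then `Φ(χ^free_G) ≠ ∅`. -/
theorem stmt10 (n : ℕ) (hn : 1 ≤ n) (κ : Fin n → Fin n → Set (ℝ × ℝ))
    (hκ : KappaHyp n κ) (xlo xhi : Fin n → ℝ) (hbd : ObsBounds n κ xlo xhi)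
    (E : Fin n → Fin n → Prop) (hE : IsPriorityGraph n κ E) (ε : ℝ) (hε : 0 < ε)
    (hcyc : ∀ (m : ℕ) (v : ℕ → Fin n), IsElemCycle n E m v →
      ⋂ k ∈ Finset.range m, dil n (cylPr n κ (v k) (v (k+1))) ε = ∅) :
    ∃ φ : ℝ → Fin n → ℝ, PhiMem n (freeG n κ E) φ := by
  have hlo : ∀ d : Fin n → ℝ, 0 ≤ d → xlo ⊓ xhi - d ∈ freeG n κ E := by
    intro d hd
    rw [hE.mem_freeG_iff]
    rintro i j hij ⟨p, q, hK, -, hq⟩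
    have h1 := (hbd.lt_of_mem (hE.ne hij) hK).2
    have h2 : (xlo ⊓ xhi) j ≤ xlo j := inf_le_left (a := xlo) (b := xhi) j
    have h3 : 0 ≤ d j := hd j
    rw [Pi.sub_apply] at hq
    linarith
  have hhi : ∀ d : Fin n → ℝ, 0 ≤ d → xhi + d ∈ freeG n κ E := by
    intro d hd
    rw [hE.mem_freeG_iff]
    rintro i j hij ⟨p, q, hK, hp, -⟩
    have h1 := (hbd.lt_of_mem (hE.ne hij) hK).1
    have h3 : 0 ≤ d i := hd i
    rw [Pi.add_apply] at hp
    linarith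
  obtain ⟨φ, hc, hm, hC, h0, h1⟩ := monoJoined_freeG hbd hE hε hcyc
    (by simpa using hlo 0 le_rfl) inf_le_right
  refine ⟨φ, hc.continuousOn, fun s _ t _ hst => hm hst, fun t _ => hC t, ?_, ?_⟩
  · rwa [h0 0 le_rfl]
  · rwa [h1 1 le_rfl]
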